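/- There exist constants c, c' > 0 and N such that the following holds for every even n ≥ N: for every Dyck word σ with |σ| ≤ c·√n and every nondeterministic finite automaton A over the alphabet Σ_n whose language L(A) has Parikh image equal to the universal one-counter set U_n, the number of states of A is at least n^{c'·width(σ)}. -/

import Mathlib

/-- A Dyck word: entries ±1, total sum zero, all prefix sums nonnegative. -/
def IsDyck (w : List ℤ) : Prop :=
  (∀ a ∈ w, a = 1 ∨ a = -1) ∧ w.sum = 0 ∧ ∀ k, 0 ≤ (w.take k).sum

/-- Width of a finite set of naturals: the least number of intervals of
consecutive integers whose union equals the set. -/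
noncomputable def setWidth (S : Finset ℕ) : ℕ :=
  sInf {k | ∃ f : Fin k → ℕ × ℕ, (S : Set ℕ) = ⋃ i, Set.Icc (f i).1 (f i).2}

/-- A re-pairing of a word `w` over `{+1, -1}` (positions are 0-based):
a sequence of pairs (ℓᵢ, rᵢ) with w(ℓᵢ) = +1, w(rᵢ) = −1, ℓᵢ < rᵢ, such that
every position of `w` occurs in exactly one pair. -/
structure RePairing (w : List ℤ) where
  pairs : List (ℕ × ℕ)
  perm : (pairs.flatMap fun q => [q.1, q.2]).Perm (List.range w.length)
  lt : ∀ q ∈ pairs, q.1 < q.2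
  plus : ∀ q ∈ pairs, w.getD q.1 0 = 1
  minus : ∀ q ∈ pairs, w.getD q.2 0 = -1

/-- The width of a re-pairing: maximum over times `t` of the width of the set
of positions erased within the first `t` pairs. -/
noncomputable def repWidth {w : List ℤ} (p : RePairing w) : ℕ :=
  (Finset.range (p.pairs.length + 1)).sup
    fun t => setWidth ((p.pairs.take t).flatMap fun q => [q.1, q.2]).toFinset

/-- Width of a word: minimum width over all its re-pairings. -/
noncomputable def dyckWidth (w : List ℤ) : ℕ :=
  sInf {k | ∃ p : RePairing w, repWidth p = k}

/-- The alphabet Σₙ = {c i j} ∪ {a i} (the letters `c i j` are only meaningful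
for i < j; Parikh vectors in the universal one-counter set force the count of
any letter `c i j` with i ≥ j to be zero). -/
inductive Alph (n : ℕ) where
  | c (i j : Fin n) : Alph n
  | a (i : Fin n) : Alph n
deriving DecidableEq

/-- The graph with edge relation `y` is a monotone path (chain) from 0 to n−1:
its edges are exactly the consecutive pairs of a strictly increasing sequence
of vertices starting at 0 and ending at n−1. -/
def IsChainGraph (n : ℕ) (y : Fin n → Fin n → Prop) : Prop :=
  ∃ (k : ℕ) (v : Fin (k + 1) → Fin n),
    StrictMono v ∧ (v 0 : ℕ) = 0 ∧ (v (Fin.last k) : ℕ) = n - 1 ∧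
    ∀ i j : Fin n, y i j ↔ ∃ t : Fin k, v t.castSucc = i ∧ v t.succ = j

/-- The universal one-counter set Uₙ, as a set of Parikh vectors over Σₙ:
writing y i j = f (c i j) and x i = f (a i), we require (U1) the y's are 0/1
and form a chain from 0 to n−1, (U3) the x's are balanced, and (U4) the x's
are compatible with the chain. -/
def UniversalOCA (n : ℕ) : Set (Alph n → ℕ) :=
  { f |
    (∀ i j : Fin n, ¬ i < j → f (.c i j) = 0) ∧
    (∀ i j : Fin n, f (.c i j) ≤ 1) ∧
    IsChainGraph n (fun i j => f (.c i j) = 1) ∧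
    (∑ i : Fin n, (-1 : ℤ) ^ (i : ℕ) * (f (.a i) : ℤ) = 0) ∧
    (∀ k : ℕ, k < n - 1 →
      0 ≤ ∑ i ∈ Finset.univ.filter (fun i : Fin n => (i : ℕ) ≤ k),
        (-1 : ℤ) ^ (i : ℕ) * (f (.a i) : ℤ)) ∧
    (∀ j : Fin n, 0 < f (.a j) →
      ((0 < (j : ℕ) → ∃ i, f (.c i j) = 1) ∧
       ((j : ℕ) < n - 1 → ∃ k, f (.c j k) = 1))) }

/-- Parikh image of the language accepted by an NFA. -/
def ParikhImage {α : Type*} [DecidableEq α] {σ : Type*} (M : NFA α σ) :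
    Set (α → ℕ) :=
  { g | ∃ w ∈ M.accepts, ∀ l : α, g l = w.count l }

namespace NFA

variable {α Q : Type*} {M : NFA α Q}

theorem mem_evalFrom_append_iff {S : Set Q} {u v : List α} {r : Q} :
    r ∈ M.evalFrom S (u ++ v) ↔ ∃ q ∈ M.evalFrom S u, r ∈ M.evalFrom {q} v := by
  rw [evalFrom_append, mem_evalFrom_iff_exists]

theorem mem_evalFrom_flatten_replicate {s : Q} {γ : List α} (h : s ∈ M.evalFrom {s} γ) (m : ℕ) :
    s ∈ M.evalFrom {s} (List.replicate m γ).flatten := by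
  induction m with
  | zero => simp
  | succ m ih =>
    rw [List.replicate_succ, List.flatten_cons, mem_evalFrom_append_iff]
    exact ⟨s, h, ih⟩

theorem mem_accepts_append {u v : List α} {q : Q} (hu : q ∈ M.evalFrom M.start u)
    (hv : ∃ r ∈ M.accept, r ∈ M.evalFrom {q} v) : u ++ v ∈ M.accepts := by
  obtain ⟨r, hr, hv⟩ := hv
  exact ⟨r, hr, mem_evalFrom_append_iff.2 ⟨q, hu, hv⟩⟩

variable (M) in
/-- `LoopDecomp M p w r L`: the word `w` labels a run from `p` to `r` that splits into the loops
`L` (each recorded with its base state) joined by single transitions. -/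
inductive LoopDecomp : Q → List α → Q → List (Q × List α) → Prop
  | single {s : Q} {γ : List α} : s ∈ M.evalFrom {s} γ → LoopDecomp s γ s [(s, γ)]
  | cons {s t r : Q} {γ w : List α} {a : α} {L : List (Q × List α)} :
      s ∈ M.evalFrom {s} γ → t ∈ M.step s a → LoopDecomp t w r L →
      LoopDecomp s (γ ++ a :: w) r ((s, γ) :: L)

namespace LoopDecomp

variable {p q r s : Q} {w γ : List α} {L : List (Q × List α)}

theorem run (h : M.LoopDecomp p w r L) : r ∈ M.evalFrom {p} w := by
  induction h with
  | single h => exact h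
  | cons h ht _ ih =>
    refine mem_evalFrom_append_iff.2 ⟨_, h, ?_⟩
    rw [evalFrom_cons, stepSet_singleton, mem_evalFrom_iff_exists]
    exact ⟨_, ht, ih⟩

theorem prepend_loop (h : M.LoopDecomp p w r L) (hγ : p ∈ M.evalFrom {p} γ) :
    ∃ L', M.LoopDecomp p (γ ++ w) r L' ∧ L'.map Prod.fst = L.map Prod.fst := by
  cases h with
  | single h => exact ⟨_, single (mem_evalFrom_append_iff.2 ⟨_, hγ, h⟩), rfl⟩
  | cons h ht h' =>
    rw [← List.append_assoc]
    exact ⟨_, cons (mem_evalFrom_append_iff.2 ⟨_, hγ, h⟩) ht h', rfl⟩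

theorem split_at_state (h : M.LoopDecomp p w r L) (hs : s ∈ L.map Prod.fst) :
    ∃ u v L', w = u ++ v ∧ s ∈ M.evalFrom {p} u ∧ M.LoopDecomp s v r L' ∧ L' <:+ L := by
  induction h with
  | @single s' γ h =>
    obtain rfl : s = s' := by simpa using hs
    exact ⟨[], γ, _, rfl, by simp, single h, List.suffix_rfl⟩
  | @cons s' t r γ w a L h ht h' ih =>
    by_cases hss : s = s'
    · subst hss
      exact ⟨[], _, _, rfl, by simp, cons h ht h', List.suffix_rfl⟩
    · obtain ⟨u, v, L', rfl, hu, hv, hL⟩ := ih (by simpa [hss] using hs)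
      refine ⟨γ ++ a :: u, v, L', by simp, ?_, hv, hL.trans (List.suffix_cons _ _)⟩
      refine mem_evalFrom_append_iff.2 ⟨_, h, ?_⟩
      rw [evalFrom_cons, stepSet_singleton, mem_evalFrom_iff_exists]
      exact ⟨_, ht, hu⟩

theorem exists_nodup (h : r ∈ M.evalFrom {p} w) :
    ∃ L, M.LoopDecomp p w r L ∧ (L.map Prod.fst).Nodup := by
  induction w generalizing p with
  | nil =>
    obtain rfl : r = p := by simpa using h
    exact ⟨_, single (γ := []) (by simp), by simp⟩
  | cons a w ih =>
    rw [evalFrom_cons, stepSet_singleton, mem_evalFrom_iff_exists] at h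
    obtain ⟨t, ht, h⟩ := h
    obtain ⟨L, hL, hnd⟩ := ih h
    by_cases hp : p ∈ L.map Prod.fst
    · obtain ⟨u, v, L', rfl, hu, hv, hL'⟩ := hL.split_at_state hp
      have hγ : p ∈ M.evalFrom {p} (a :: u) := by
        rw [evalFrom_cons, stepSet_singleton, mem_evalFrom_iff_exists]
        exact ⟨_, ht, hu⟩
      obtain ⟨L'', hL'', hmap⟩ := hv.prepend_loop hγ
      exact ⟨L'', hL'', hmap ▸ hnd.sublist (hL'.sublist.map _)⟩
    · exact ⟨_, cons (γ := []) (by simp) ht hL, by simpa using ⟨by simpa using hp, hnd⟩⟩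

theorem length_add_one (h : M.LoopDecomp p w r L) :
    w.length + 1 = (L.map fun x => x.2.length).sum + L.length := by
  induction h with
  | single h => simp
  | cons h ht h' ih => simp; omega

theorem sum_count_le [DecidableEq α] (h : M.LoopDecomp p w r L) (a : α) :
    (L.map fun x => x.2.count a).sum ≤ w.count a ∧
      w.count a < (L.map fun x => x.2.count a).sum + L.length := by
  induction h with
  | single h => simp
  | @cons s t r γ w b L h ht h' ih =>
    simp only [List.map_cons, List.sum_cons, List.count_append, List.count_cons, List.length_cons]
    split <;> omega

theorem split_at_loop (h : M.LoopDecomp p w r L) (i : ℕ) (hi : i < L.length) :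
    ∃ u v, w = u ++ (L[i].2 ++ v) ∧ L[i].1 ∈ M.evalFrom {p} u ∧
      L[i].1 ∈ M.evalFrom {L[i].1} L[i].2 ∧ r ∈ M.evalFrom {L[i].1} v ∧
      (∀ j (hj : j < L.length), j < i → L[j].2 ⊆ u) ∧
      ∀ j (hj : j < L.length), i < j → L[j].2 ⊆ v := by
  induction h generalizing i with
  | @single s γ h =>
    obtain rfl : i = 0 := by simpa using hi
    refine ⟨[], [], by simp, by simp, by simpa using h, by simp, by simp, ?_⟩
    intro j hj hj'
    simp at hj; omega
  | @cons s t r γ w a L h ht h' ih =>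
    cases i with
    | zero =>
      refine ⟨[], a :: w, by simp, by simp, by simpa using h, ?_, by simp, ?_⟩
      · simp only [List.getElem_cons_zero]
        rw [evalFrom_cons, stepSet_singleton, mem_evalFrom_iff_exists]
        exact ⟨_, ht, h'.run⟩
      · intro j hj hj'
        obtain ⟨j, rfl⟩ : ∃ k, j = k + 1 := ⟨j - 1, by omega⟩
        simp only [List.length_cons, Nat.add_lt_add_iff_right] at hj
        obtain ⟨u, v, hw, -⟩ := ih j hj
        intro x hx
        simp only [List.getElem_cons_succ] at hx
        rw [hw]
        simp [hx]
    | succ i =>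
      simp only [List.length_cons, Nat.add_lt_add_iff_right] at hi
      obtain ⟨u, v, hw, hu, hl, hv, h1, h2⟩ := ih i hi
      refine ⟨γ ++ a :: u, v, by simp [← hw], ?_, by simpa using hl, by simpa using hv, ?_, ?_⟩
      · refine mem_evalFrom_append_iff.2 ⟨_, h, ?_⟩
        rw [evalFrom_cons, stepSet_singleton, mem_evalFrom_iff_exists]
        exact ⟨_, ht, hu⟩
      · intro j hj hj' x hx
        cases j with
        | zero => simp only [List.getElem_cons_zero] at hx; simp [hx]
        | succ j =>
          have := h1 j (by simpa using hj) (by omega) (by simpa using hx)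
          simp [this]
      · intro j hj hj'
        obtain ⟨j, rfl⟩ : ∃ k, j = k + 1 := ⟨j - 1, by omega⟩
        simpa using h2 j (by simpa using hj) (by omega)

end LoopDecomp

end NFA

theorem setWidth_empty : setWidth ∅ = 0 :=
  Nat.sInf_eq_zero.2 (Or.inl ⟨fun i => i.elim0, by simp⟩)

theorem setWidth_le_card_right_ends (S : Finset ℕ) :
    setWidth S ≤ (S.filter fun k => k + 1 ∉ S).card := by
  classical
  set T := S.filter fun k => k + 1 ∉ S with hT
  have hex : ∀ k, ∃ a, k ∈ S → Set.Icc a k ⊆ (S : Set ℕ) := fun k => ⟨k, fun h x hx => by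
    obtain rfl : x = k := le_antisymm hx.2 hx.1
    exact h⟩
  let g : ℕ → ℕ := fun k => Nat.find (hex k)
  refine Nat.sInf_le ⟨fun i => (g (T.equivFin.symm i), T.equivFin.symm i), ?_⟩
  ext x
  simp only [Set.mem_iUnion]
  constructor
  · intro hx
    have hend : ∃ d, x + d + 1 ∉ S := by
      by_contra! h
      have := Finset.le_sup (f := id) (h (S.sup id))
      simp only [id] at this
      omega
    have hin : ∀ e, e ≤ Nat.find hend → x + e ∈ S := by
      intro e he
      cases e with
      | zero => exact hx
      | succ e => exact not_not.1 (Nat.find_min hend (show e < Nat.find hend by omega))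
    have hk : x + Nat.find hend ∈ T :=
      Finset.mem_filter.2 ⟨hin _ le_rfl, Nat.find_spec hend⟩
    refine ⟨T.equivFin ⟨_, hk⟩, ?_⟩
    simp only [Equiv.symm_apply_apply, Set.mem_Icc]
    refine ⟨Nat.find_min' (hex _) fun _ y hy => ?_, by omega⟩
    obtain ⟨e, rfl⟩ := Nat.exists_eq_add_of_le hy.1
    exact hin e (by have := hy.2; omega)
  · rintro ⟨i, hi⟩
    have hmem := (T.equivFin.symm i).2
    exact Nat.find_spec (hex _) (Finset.mem_filter.1 hmem).1 hi

/-- If `S` agrees with membership of both neighbouring edges in `E` outside `D`, then the width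
of `S` is controlled by the size of `D`. -/
theorem setWidth_le_of_agree {N : ℕ} {S D : Finset ℕ} {E : ℕ → Prop} (hS : S ⊆ Finset.range N)
    (hin : ∀ k < N, k ∈ S → k ∉ D → E (k + 1))
    (hout : ∀ k < N, k ∉ S → k ∉ D → ¬ E k) :
    setWidth S ≤ 2 * D.card + 1 := by
  classical
  refine (setWidth_le_card_right_ends S).trans ?_
  have hsub : (S.filter fun k => k + 1 ∉ S) ⊆ D ∪ D.image (· - 1) ∪ {N - 1} := by
    intro k hk
    obtain ⟨hkS, hk1⟩ := Finset.mem_filter.1 hk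
    have hkN := Finset.mem_range.1 (hS hkS)
    simp only [Finset.mem_union, Finset.mem_image, Finset.mem_singleton]
    by_contra! h
    obtain ⟨⟨hkD, hkD'⟩, hne⟩ := h
    exact hout (k + 1) (by omega) hk1 (fun hD => hkD' _ hD (by omega)) (hin k hkN hkS hkD)
  refine (Finset.card_le_card hsub).trans ((Finset.card_union_le _ _).trans ?_)
  have h1 := Finset.card_union_le D (D.image (· - 1))
  have h2 := Finset.card_image_le (s := D) (f := (· - 1))
  simp only [Finset.card_singleton]
  omega

/-- Loops whose weights on the positions have nonpositive signed suffix sums, and which almost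
cover a constant weight `K` on every position, carry a matching of the `+1`s to later `-1`s. -/
theorem exists_matching_of_loops {N m : ℕ} (hm : 0 < m) {s : ℕ → ℤ} (hs : ∀ k < N, s k = 1 ∨ s k = -1)
    (z : Fin m → ℕ → ℕ) {K R : ℕ}
    (hsuf : ∀ i, ∀ k₀ < N, ∑ k ∈ Finset.Ico k₀ N, s k * z i k ≤ 0)
    (hup : ∀ k < N, ∑ i, z i k ≤ K) (hlow : ∀ k < N, K ≤ ∑ i, z i k + R) (hK : N * R < K) :
    ∃ (φ : ℕ → ℕ) (ι : ℕ → Fin m), (∀ k < N, ∀ k' < N, s k = 1 → s k' = 1 → φ k = φ k' → k = k') ∧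
      ∀ k < N, s k = 1 → k < φ k ∧ φ k < N ∧ s (φ k) = -1 ∧ 0 < z (ι k) k ∧ 0 < z (ι k) (φ k) := by
  classical
  set P := (Finset.range N).filter fun k => s k = 1 with hP
  let t : P → Finset ℕ := fun k => (Finset.range N).filter fun r =>
    k.1 < r ∧ s r = -1 ∧ ∃ i, 0 < z i k ∧ 0 < z i r
  have hall : ∀ X : Finset P, X.card ≤ (X.biUnion t).card := by
    intro X
    set X' := X.image Subtype.val with hX'
    set B := X.biUnion t with hB
    have hcard : X.card = X'.card := (Finset.card_image_of_injective _ Subtype.val_injective).symm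
    have hX'P : X' ⊆ P := by
      intro k hk
      obtain ⟨x, -, rfl⟩ := Finset.mem_image.1 hk
      exact x.2
    have hX'N : ∀ k ∈ X', k < N := fun k hk =>
      Finset.mem_range.1 (Finset.mem_filter.1 (hX'P hk)).1
    have hBN : ∀ k ∈ B, k < N := by
      intro k hk
      obtain ⟨x, -, hx⟩ := Finset.mem_biUnion.1 hk
      exact Finset.mem_range.1 (Finset.mem_filter.1 hx).1
    have hloop : ∀ i, ∑ k ∈ X', z i k ≤ ∑ r ∈ B, z i r := by
      intro i
      rw [← Finset.sum_filter_of_ne (p := fun k => 0 < z i k) (fun k _ hk => by omega)]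
      rcases (X'.filter fun k => 0 < z i k).eq_empty_or_nonempty with he | hne
      · simp [he]
      set k₀ := (X'.filter fun k => 0 < z i k).min' hne with hk₀
      have hk₀mem := Finset.mem_filter.1 (Finset.min'_mem _ hne)
      rw [← hk₀] at hk₀mem
      have hk₀P := Finset.mem_filter.1 (hX'P hk₀mem.1)
      have h1 : ∑ k ∈ X'.filter (fun k => 0 < z i k), z i k ≤
          ∑ k ∈ (Finset.Ico k₀ N).filter (fun k => s k = 1), z i k := by
        refine Finset.sum_le_sum_of_subset fun k hk => ?_
        have hk' := Finset.mem_filter.1 hk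
        exact Finset.mem_filter.2 ⟨Finset.mem_Ico.2 ⟨Finset.min'_le _ _ hk, hX'N _ hk'.1⟩,
          (Finset.mem_filter.1 (hX'P hk'.1)).2⟩
      have h2 : ∑ k ∈ (Finset.Ico k₀ N).filter (fun k => s k = 1), z i k ≤
          ∑ k ∈ (Finset.Ico k₀ N).filter (fun k => s k = -1), z i k := by
        have h := hsuf i k₀ (hX'N _ hk₀mem.1)
        have heq : ∑ k ∈ Finset.Ico k₀ N, s k * z i k =
            (∑ k ∈ (Finset.Ico k₀ N).filter (fun k => s k = 1), (z i k : ℤ)) -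
            ∑ k ∈ (Finset.Ico k₀ N).filter (fun k => s k = -1), (z i k : ℤ) := by
          rw [Finset.sum_filter, Finset.sum_filter, ← Finset.sum_sub_distrib]
          refine Finset.sum_congr rfl fun k hk => ?_
          rcases hs k (Finset.mem_Ico.1 hk).2 with h | h <;> simp [h]
        rw [heq] at h
        zify
        linarith
      have h3 : ∑ k ∈ (Finset.Ico k₀ N).filter (fun k => s k = -1), z i k ≤ ∑ r ∈ B, z i r := by
        rw [← Finset.sum_filter_of_ne (p := fun k => 0 < z i k) (fun k _ hk => by omega)]
        refine Finset.sum_le_sum_of_subset fun r hr => ?_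
        simp only [Finset.mem_filter, Finset.mem_Ico] at hr
        obtain ⟨⟨⟨hr1, hr2⟩, hr3⟩, hr4⟩ := hr
        obtain ⟨x, hxX, hx⟩ := Finset.mem_image.1 hk₀mem.1
        refine Finset.mem_biUnion.2 ⟨x, hxX, Finset.mem_filter.2 ⟨Finset.mem_range.2 hr2, ?_,
          hr3, i, ?_, hr4⟩⟩
        · rw [hx]
          refine lt_of_le_of_ne hr1 fun h => ?_
          have := hk₀P.2
          rw [h, hr3] at this
          norm_num at this
        · rw [hx]
          exact hk₀mem.2
      exact h1.trans (h2.trans h3)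
    have h1 : X'.card * K ≤ ∑ k ∈ X', ∑ i, z i k + X'.card * R := by
      have : ∑ k ∈ X', K ≤ ∑ k ∈ X', (∑ i, z i k + R) :=
        Finset.sum_le_sum fun k hk => hlow k (hX'N k hk)
      simpa [Finset.sum_add_distrib] using this
    have h2 : ∑ k ∈ X', ∑ i, z i k ≤ ∑ r ∈ B, ∑ i, z i r := by
      rw [Finset.sum_comm, Finset.sum_comm (s := B)]
      exact Finset.sum_le_sum fun i _ => hloop i
    have h3 : ∑ r ∈ B, ∑ i, z i r ≤ B.card * K := by
      simpa using Finset.sum_le_sum (fun r hr => hup r (hBN r hr))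
    have h4 : X'.card ≤ N := by
      simpa using Finset.card_le_card
        (fun k hk => Finset.mem_range.2 (hX'N k hk) : X' ⊆ Finset.range N)
    have h5 : X'.card * R ≤ N * R := Nat.mul_le_mul_right _ h4
    have h6 : X'.card * K < (B.card + 1) * K := by
      rw [add_mul]
      omega
    have h7 := lt_of_mul_lt_mul_right h6 (Nat.zero_le K)
    omega
  obtain ⟨f, hinj, hf⟩ := (Finset.all_card_le_biUnion_card_iff_exists_injective t).1 hall
  have hmem : ∀ k, k < N → s k = 1 → k ∈ P := fun k hk h1 =>
    Finset.mem_filter.2 ⟨Finset.mem_range.2 hk, h1⟩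
  have hf' : ∀ k (hk : k < N) (h1 : s k = 1), f ⟨k, hmem k hk h1⟩ < N ∧
      k < f ⟨k, hmem k hk h1⟩ ∧ s (f ⟨k, hmem k hk h1⟩) = -1 ∧
      ∃ i, 0 < z i k ∧ 0 < z i (f ⟨k, hmem k hk h1⟩) := fun k hk h1 => by
    simpa [t] using hf ⟨k, hmem k hk h1⟩
  have hι : ∀ k, ∃ i : Fin m, ∀ (hk : k < N) (h1 : s k = 1),
      0 < z i k ∧ 0 < z i (f ⟨k, hmem k hk h1⟩) := by
    intro k
    by_cases h : k < N ∧ s k = 1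
    · obtain ⟨-, -, -, i, hi⟩ := hf' k h.1 h.2
      exact ⟨i, fun _ _ => hi⟩
    · exact ⟨⟨0, hm⟩, fun h1 h2 => absurd ⟨h1, h2⟩ h⟩
  choose ι hι using hι
  refine ⟨fun k => if h : k < N ∧ s k = 1 then f ⟨k, hmem k h.1 h.2⟩ else 0, ι, ?_, ?_⟩
  · intro k hk k' hk' h1 h1' heq
    simp only [hk, h1, hk', h1', and_self, dif_pos] at heq
    exact congrArg Subtype.val (hinj heq)
  · intro k hk h1
    simp only [hk, h1, and_self, dif_pos]
    obtain ⟨a, b, c, -⟩ := hf' k hk h1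
    exact ⟨b, a, c, hι k hk h1⟩

theorem IsDyck.getD_eq {σ : List ℤ} (hσ : IsDyck σ) {k : ℕ} (hk : k < σ.length) :
    σ.getD k 0 = 1 ∨ σ.getD k 0 = -1 := by
  rw [List.getD_eq_getElem _ _ hk]
  exact hσ.1 _ (List.getElem_mem hk)

theorem List.sum_take_eq_sum_range (σ : List ℤ) (m : ℕ) :
    (σ.take m).sum = ∑ k ∈ Finset.range m, σ.getD k 0 := by
  induction m with
  | zero => simp
  | succ m ih =>
    rw [Finset.sum_range_succ, ← ih]
    by_cases h : m < σ.length
    · rw [List.sum_take_succ _ _ h, List.getD_eq_getElem _ _ h]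
    · rw [List.take_of_length_le (by omega), List.take_of_length_le (by omega),
        List.getD_eq_default _ _ (by omega), add_zero]

theorem IsDyck.exists_rePairing {σ : List ℤ} (hσ : IsDyck σ) {m : ℕ} {φ : ℕ → ℕ} (ι : ℕ → Fin m)
    (hinj : ∀ k < σ.length, ∀ k' < σ.length, σ.getD k 0 = 1 → σ.getD k' 0 = 1 →
      φ k = φ k' → k = k')
    (hφ : ∀ k < σ.length, σ.getD k 0 = 1 → k < φ k ∧ φ k < σ.length ∧ σ.getD (φ k) 0 = -1) :
    ∃ p : RePairing σ, (p.pairs.Pairwise fun a b => ι a.1 ≤ ι b.1) ∧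
      ∀ q ∈ p.pairs, q.2 = φ q.1 := by
  classical
  set N := σ.length with hN
  set P := (Finset.range N).filter fun k => σ.getD k 0 = 1 with hP
  let l := P.toList.insertionSort fun a b => ι a ≤ ι b
  have hl : ∀ k, k ∈ l ↔ k < N ∧ σ.getD k 0 = 1 := fun k => by
    simp [l, hP, -List.getD_eq_getElem?_getD]
  have hnd : l.Nodup := (List.perm_insertionSort _ _).nodup_iff.2 P.nodup_toList
  have hlen : l.length = P.card := by simp [l]
  have hsort : l.Pairwise fun a b => ι a ≤ ι b := by
    have : IsTrans ℕ (fun a b => ι a ≤ ι b) := ⟨fun a b c => le_trans⟩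
    have : Std.Total (fun a b : ℕ => ι a ≤ ι b) := ⟨fun a b => le_total _ _⟩
    exact List.pairwise_insertionSort _ _
  have hcard : 2 * P.card = N := by
    have h1 : ∑ k ∈ Finset.range N, σ.getD k 0 = 0 := by
      rw [← List.sum_take_eq_sum_range, List.take_length, hσ.2.1]
    have h2 : ∀ k ∈ Finset.range N, σ.getD k 0 = 2 * (if σ.getD k 0 = 1 then 1 else 0) - 1 := by
      intro k hk
      rcases hσ.getD_eq (Finset.mem_range.1 hk) with h | h <;> rw [h] <;> norm_num
    rw [Finset.sum_congr rfl h2, Finset.sum_sub_distrib, ← Finset.mul_sum, Finset.sum_boole] at h1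
    simp only [Finset.sum_const, Finset.card_range, nsmul_eq_mul, mul_one] at h1
    zify
    linarith
  have hlt : ∀ k ∈ l, k < φ k ∧ φ k < N ∧ σ.getD (φ k) 0 = -1 := fun k hk =>
    hφ k ((hl k).1 hk).1 ((hl k).1 hk).2
  refine ⟨⟨l.map fun k => (k, φ k), ?_, ?_, ?_, ?_⟩, ?_, ?_⟩
  · rw [List.flatMap_map]
    apply List.Subperm.perm_of_length_le
    · refine List.subperm_of_subset ?_ ?_
      · refine List.nodup_flatMap.2 ⟨fun k hk => ?_, ?_⟩
        · simpa using (hlt k hk).1.ne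
        · refine hnd.imp_of_mem ?_
          intro a b ha hb hab
          have ha' := (hl a).1 ha
          have hb' := (hl b).1 hb
          have hpm : ∀ x y, σ.getD x 0 = 1 → σ.getD y 0 = -1 → x ≠ y := by
            rintro x y hx hy rfl
            rw [hx] at hy
            norm_num at hy
          intro x hx hx'
          simp only [List.mem_cons, List.not_mem_nil, or_false] at hx hx'
          rcases hx with rfl | rfl <;> rcases hx' with h | h
          · exact hab h
          · exact hpm _ _ ha'.2 (hlt b hb).2.2 h
          · exact hpm _ _ hb'.2 (hlt a ha).2.2 h.symm
          · exact hab (hinj _ ha'.1 _ hb'.1 ha'.2 hb'.2 h)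
      · intro x hx
        obtain ⟨k, hk, hx⟩ := List.mem_flatMap.1 hx
        have := hlt k hk
        simp only [List.mem_cons, List.not_mem_nil, or_false] at hx
        rw [List.mem_range]
        rcases hx with rfl | rfl <;> omega
    · simp [List.length_flatMap, hlen]
      omega
  · intro q hq
    obtain ⟨k, hk, rfl⟩ := List.mem_map.1 hq
    exact (hlt k hk).1
  · intro q hq
    obtain ⟨k, hk, rfl⟩ := List.mem_map.1 hq
    exact ((hl k).1 hk).2
  · intro q hq
    obtain ⟨k, hk, rfl⟩ := List.mem_map.1 hq
    exact (hlt k hk).2.2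
  · exact List.pairwise_map.2 hsort
  · intro q hq
    obtain ⟨k, hk, rfl⟩ := List.mem_map.1 hq
    rfl

theorem RePairing.exists_prefix_width {σ : List ℤ} (p : RePairing σ) :
    ∃ t, dyckWidth σ ≤
      setWidth ((p.pairs.take t).flatMap fun q => [q.1, q.2]).toFinset := by
  obtain ⟨t, -, ht⟩ := Finset.exists_mem_eq_sup (Finset.range (p.pairs.length + 1)) (by simp)
    fun t => setWidth ((p.pairs.take t).flatMap fun q => [q.1, q.2]).toFinset
  exact ⟨t, ht ▸ Nat.sInf_le ⟨p, rfl⟩⟩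

theorem IsDyck.exists_wide_split {σ : List ℤ} (hσ : IsDyck σ) (hw : 0 < dyckWidth σ) {m : ℕ}
    (hm : 0 < m) (z : Fin m → ℕ → ℕ) {K R : ℕ}
    (hsuf : ∀ i, ∀ k₀ < σ.length, ∑ k ∈ Finset.Ico k₀ σ.length, σ.getD k 0 * z i k ≤ 0)
    (hup : ∀ k < σ.length, ∑ i, z i k ≤ K) (hlow : ∀ k < σ.length, K ≤ ∑ i, z i k + R)
    (hK : σ.length * R < K) :
    ∃ S ⊆ Finset.range σ.length, dyckWidth σ ≤ setWidth S ∧ ∃ i : Fin m, ∀ k < σ.length,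
      (k ∈ S → ∃ j ≤ i, 0 < z j k) ∧ (k ∉ S → ∃ j ≥ i, 0 < z j k) := by
  obtain ⟨φ, ι, hinj, hφ⟩ := exists_matching_of_loops hm (fun k hk => hσ.getD_eq hk) z hsuf hup
    hlow hK
  obtain ⟨p, hsort, hp⟩ := hσ.exists_rePairing ι hinj
    fun k hk h1 => ⟨(hφ k hk h1).1, (hφ k hk h1).2.1, (hφ k hk h1).2.2.1⟩
  obtain ⟨t, ht⟩ := p.exists_prefix_width
  have hmem : ∀ k, k ∈ (p.pairs.flatMap fun q => [q.1, q.2]) ↔ k < σ.length := fun k => by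
    rw [p.perm.mem_iff, List.mem_range]
  have hz : ∀ q ∈ p.pairs, ∀ k ∈ [q.1, q.2], 0 < z (ι q.1) k := by
    intro q hq k hk
    have h1 : q.1 < σ.length := (hmem _).1 (List.mem_flatMap.2 ⟨q, hq, by simp⟩)
    have h2 := hφ q.1 h1 (p.plus q hq)
    rw [← hp q hq] at h2
    simp only [List.mem_cons, List.not_mem_nil, or_false] at hk
    rcases hk with rfl | rfl
    exacts [h2.2.2.2.1, h2.2.2.2.2]
  refine ⟨_, ?_, ht, ?_⟩
  · intro k hk
    rw [List.mem_toFinset] at hk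
    obtain ⟨q, hq, hk⟩ := List.mem_flatMap.1 hk
    exact Finset.mem_range.2 ((hmem k).1 (List.mem_flatMap.2 ⟨q, List.mem_of_mem_take hq, hk⟩))
  have hne : p.pairs.take t ≠ [] := by
    intro h
    simp only [h, List.flatMap_nil, List.toFinset_nil, setWidth_empty] at ht
    omega
  set q₀ := (p.pairs.take t).getLast hne with hq₀
  have hsort' := hsort
  rw [← List.take_append_drop t p.pairs, List.pairwise_append] at hsort'
  obtain ⟨hs1, -, hs3⟩ := hsort'
  have hle : ∀ q ∈ p.pairs.take t, ι q.1 ≤ ι q₀.1 := by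
    intro q hq
    rw [← List.dropLast_append_getLast hne, List.pairwise_append] at hs1
    rw [← List.dropLast_append_getLast hne, List.mem_append] at hq
    rcases hq with hq | hq
    · exact hs1.2.2 q hq _ (by simp [hq₀])
    · simp only [List.mem_singleton] at hq
      rw [hq]
  refine ⟨ι q₀.1, fun k hk => ⟨fun hkS => ?_, fun hkS => ?_⟩⟩
  · rw [List.mem_toFinset] at hkS
    obtain ⟨q, hq, hkq⟩ := List.mem_flatMap.1 hkS
    exact ⟨ι q.1, hle q hq, hz q (List.mem_of_mem_take hq) k hkq⟩
  · rw [List.mem_toFinset] at hkS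
    obtain ⟨q, hq, hkq⟩ := List.mem_flatMap.1 ((hmem k).2 hk)
    rw [← List.take_append_drop t p.pairs, List.mem_append] at hq
    rcases hq with hq | hq
    · exact absurd (List.mem_flatMap.2 ⟨q, hq, hkq⟩) hkS
    · exact ⟨ι q.1, hs3 _ (List.getLast_mem hne) q hq,
        hz q (List.mem_of_mem_drop hq) k hkq⟩

section UniversalSet

variable {n : ℕ}

theorem IsChainGraph.eq_of_overlap {y : Fin n → Fin n → Prop} (hy : IsChainGraph n y)
    {i j i' j' : Fin n} (h : y i j) (h' : y i' j') (h1 : i < j') (h2 : i' < j) :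
    i = i' ∧ j = j' := by
  obtain ⟨k, v, hv, -, -, hE⟩ := hy
  obtain ⟨t, rfl, rfl⟩ := (hE _ _).1 h
  obtain ⟨t', rfl, rfl⟩ := (hE _ _).1 h'
  have h1 := hv.lt_iff_lt.1 h1
  have h2 := hv.lt_iff_lt.1 h2
  rw [Fin.lt_def] at h1 h2
  simp only [Fin.val_castSucc, Fin.val_succ] at h1 h2
  obtain rfl : t = t' := Fin.ext (by omega)
  exact ⟨rfl, rfl⟩

theorem IsChainGraph.exists_edge_le {y : Fin n → Fin n → Prop} (hy : IsChainGraph n y)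
    {i i' : Fin n} (h : ∃ j, y i j ∨ y j i) (h' : ∃ j, y i' j ∨ y j i') (hlt : i < i') :
    ∃ l, y i l ∧ l ≤ i' := by
  obtain ⟨k, v, hv, -, -, hE⟩ := hy
  have hvert : ∀ i, (∃ j, y i j ∨ y j i) → ∃ t, v t = i := by
    rintro i ⟨j, h | h⟩
    · obtain ⟨t, ht, -⟩ := (hE _ _).1 h
      exact ⟨_, ht⟩
    · obtain ⟨t, -, ht⟩ := (hE _ _).1 h
      exact ⟨_, ht⟩
  obtain ⟨t, rfl⟩ := hvert i h
  obtain ⟨t', rfl⟩ := hvert i' h'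
  have hlt := hv.lt_iff_lt.1 hlt
  rw [Fin.lt_def] at hlt
  have ht'k := t'.2
  refine ⟨v (Fin.succ ⟨t, by omega⟩), (hE _ _).2 ⟨⟨t, by omega⟩, rfl, rfl⟩, hv.monotone ?_⟩
  rw [Fin.le_def]
  simp only [Fin.val_succ]
  omega

/-- The vector whose edges form the chain `p 0 < ⋯ < p (N + 1)` and whose letters `a` occur
`K` times at each inner vertex of that chain. -/
noncomputable def chainVec (p : ℕ → Fin n) (N K : ℕ) : Alph n → ℕ := by
  classical
  exact fun
  | .c i j => if ∃ e ≤ N, p e = i ∧ p (e + 1) = j then 1 else 0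
  | .a i => if ∃ k < N, p (k + 1) = i then K else 0

/-- `p 0 < ⋯ < p (N + 1)` is a chain from `0` to `n - 1` whose inner vertices have the parities
prescribed by `σ`. -/
structure IsChainFor (σ : List ℤ) (p : ℕ → Fin n) : Prop where
  strictMonoOn : StrictMonoOn p (Set.Iic (σ.length + 1))
  zero : (p 0 : ℕ) = 0
  last : (p (σ.length + 1) : ℕ) = n - 1
  sign : ∀ k < σ.length, (-1 : ℤ) ^ (p (k + 1) : ℕ) = σ.getD k 0

namespace IsChainFor

variable {σ : List ℤ} {p : ℕ → Fin n}

theorem lt_iff (hp : IsChainFor σ p) {k l : ℕ} (hk : k ≤ σ.length + 1) (hl : l ≤ σ.length + 1) :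
    p k < p l ↔ k < l :=
  hp.strictMonoOn.lt_iff_lt hk hl

theorem le_iff (hp : IsChainFor σ p) {k l : ℕ} (hk : k ≤ σ.length + 1) (hl : l ≤ σ.length + 1) :
    p k ≤ p l ↔ k ≤ l :=
  hp.strictMonoOn.le_iff_le hk hl

theorem inj (hp : IsChainFor σ p) {k l : ℕ} (hk : k ≤ σ.length + 1) (hl : l ≤ σ.length + 1)
    (h : p k = p l) : k = l :=
  hp.strictMonoOn.injOn hk hl h

theorem isChainGraph (hp : IsChainFor σ p) {K : ℕ} :
    IsChainGraph n fun i j => chainVec p σ.length K (.c i j) = 1 := by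
  refine ⟨σ.length + 1, fun t => p t, ?_, by simpa using hp.zero, by simpa using hp.last, ?_⟩
  · intro a b hab
    exact (hp.lt_iff (by omega) (by omega)).2 hab
  · intro i j
    simp only [chainVec, ite_eq_left_iff, zero_ne_one, imp_false, not_not]
    constructor
    · rintro ⟨e, he, rfl, rfl⟩
      exact ⟨⟨e, by omega⟩, rfl, rfl⟩
    · rintro ⟨t, rfl, rfl⟩
      exact ⟨t, by omega, rfl, rfl⟩

theorem sum_filter_eq (hp : IsChainFor σ p) (φ : Fin n → Prop) [DecidablePred φ] {g : Fin n → ℕ}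
    (hg : ∀ i, g i ≠ 0 → ∃ k < σ.length, p (k + 1) = i) :
    ∑ i ∈ Finset.univ.filter φ, (-1 : ℤ) ^ (i : ℕ) * (g i : ℤ) =
      ∑ k ∈ (Finset.range σ.length).filter fun k => φ (p (k + 1)),
        σ.getD k 0 * (g (p (k + 1)) : ℤ) := by
  symm
  have h : ∑ k ∈ (Finset.range σ.length).filter (fun k => φ (p (k + 1))),
        σ.getD k 0 * (g (p (k + 1)) : ℤ) =
      ∑ k ∈ (Finset.range σ.length).filter (fun k => φ (p (k + 1))),
        (-1 : ℤ) ^ (p (k + 1) : ℕ) * (g (p (k + 1)) : ℤ) :=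
    Finset.sum_congr rfl fun k hk => by
      rw [hp.sign k (Finset.mem_range.1 (Finset.mem_filter.1 hk).1)]
  rw [h, ← Finset.sum_image (f := fun i : Fin n => (-1 : ℤ) ^ (i : ℕ) * (g i : ℤ))
    (g := fun k => p (k + 1))]
  · refine Finset.sum_subset ?_ ?_
    · intro i hi
      obtain ⟨k, hk, rfl⟩ := Finset.mem_image.1 hi
      exact Finset.mem_filter.2 ⟨Finset.mem_univ _, (Finset.mem_filter.1 hk).2⟩
    · intro i hi hi'
      by_contra hne
      have hgi : g i ≠ 0 := fun h => hne (by simp [h])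
      obtain ⟨k, hk, rfl⟩ := hg i hgi
      exact hi' (Finset.mem_image.2 ⟨k, Finset.mem_filter.2 ⟨Finset.mem_range.2 hk,
        (Finset.mem_filter.1 hi).2⟩, rfl⟩)
  · intro k hk l hl hkl
    have hk := Finset.mem_range.1 (Finset.mem_filter.1 (Finset.mem_coe.1 hk)).1
    have hl := Finset.mem_range.1 (Finset.mem_filter.1 (Finset.mem_coe.1 hl)).1
    have := hp.inj (by omega) (by omega) hkl
    omega

theorem chainVec_mem (hσ : IsDyck σ) (hp : IsChainFor σ p) (K : ℕ) :
    chainVec p σ.length K ∈ UniversalOCA n := by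
  have hg : ∀ i, chainVec p σ.length K (.a i) ≠ 0 → ∃ k < σ.length, p (k + 1) = i := by
    intro i hi
    by_contra h
    exact hi (by simp only [chainVec, if_neg h])
  have hval : ∀ k < σ.length, chainVec p σ.length K (.a (p (k + 1))) = K := by
    intro k hk
    simp only [chainVec]
    exact if_pos ⟨k, hk, rfl⟩
  have hedge : ∀ e ≤ σ.length, chainVec p σ.length K (.c (p e) (p (e + 1))) = 1 := by
    intro e he
    simp only [chainVec]
    exact if_pos ⟨e, he, rfl, rfl⟩
  have hsum : ∀ m ≤ σ.length, ∑ k ∈ Finset.range m,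
      σ.getD k 0 * (chainVec p σ.length K (.a (p (k + 1))) : ℤ) = (σ.take m).sum * K := by
    intro m hm
    rw [List.sum_take_eq_sum_range, Finset.sum_mul]
    exact Finset.sum_congr rfl fun k hk => by
      rw [hval k ((Finset.mem_range.1 hk).trans_le hm)]
  refine ⟨?_, ?_, hp.isChainGraph, ?_, ?_, ?_⟩
  · intro i j hij
    simp only [chainVec]
    refine if_neg ?_
    rintro ⟨e, he, rfl, rfl⟩
    exact hij ((hp.lt_iff (by omega) (by omega)).2 (by omega))
  · intro i j
    simp only [chainVec]
    split <;> simp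
  · have := hp.sum_filter_eq (fun _ => True) hg
    simp only [Finset.filter_true] at this
    rw [this, hsum _ le_rfl, List.take_length, hσ.2.1, zero_mul]
  · intro k hk
    rw [hp.sum_filter_eq _ hg]
    obtain ⟨m, hm, hmk⟩ : ∃ m ≤ σ.length,
        (Finset.range σ.length).filter (fun l => (p (l + 1) : ℕ) ≤ k) = Finset.range m := by
      by_cases h : ∃ l, l < σ.length ∧ k < p (l + 1)
      · refine ⟨Nat.find h, (Nat.find_spec h).1.le, ?_⟩
        ext l
        rw [Finset.mem_filter, Finset.mem_range, Finset.mem_range]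
        constructor
        · rintro ⟨h1, h2⟩
          by_contra! h3
          have h4 := (hp.le_iff (k := Nat.find h + 1) (l := l + 1)
            (by omega) (by omega)).2 (by omega)
          have h5 := (Nat.find_spec h).2
          rw [Fin.le_def] at h4
          omega
        · intro h1
          have h2 := Nat.find_min h h1
          have h3 := (Nat.find_spec h).1
          exact ⟨by omega, by by_contra h4; exact h2 ⟨by omega, by omega⟩⟩
      · refine ⟨_, le_rfl, Finset.filter_true_of_mem fun l hl => ?_⟩
        by_contra h4
        exact h ⟨l, Finset.mem_range.1 hl, by omega⟩
    rw [hmk, hsum m hm]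
    exact mul_nonneg (hσ.2.2 m) (Nat.cast_nonneg _)
  · intro j hj
    obtain ⟨k, hk, rfl⟩ := hg j hj.ne'
    exact ⟨fun _ => ⟨_, hedge k hk.le⟩, fun _ => ⟨_, hedge (k + 1) (by omega)⟩⟩

end IsChainFor

theorem eq_zero_of_pump {f g : Alph n → ℕ} (h : ∀ m : ℕ, f + m • g ∈ UniversalOCA n)
    (i j : Fin n) : g (.c i j) = 0 := by
  have := (h 2).2.1 i j
  simp only [Pi.add_apply, Pi.smul_apply, smul_eq_mul] at this
  omega

theorem sum_eq_zero_of_pump {f g : Alph n → ℕ} (h : ∀ m : ℕ, f + m • g ∈ UniversalOCA n) :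
    ∑ i : Fin n, (-1 : ℤ) ^ (i : ℕ) * (g (.a i) : ℤ) = 0 := by
  have h0 := (h 0).2.2.2.1
  have h1 := (h 1).2.2.2.1
  simp only [Pi.add_apply, zero_smul, Pi.zero_apply, add_zero, one_smul] at h0 h1
  push_cast at h1
  simp only [mul_add, Finset.sum_add_distrib] at h1
  linarith

theorem sum_nonneg_of_pump {f g : Alph n → ℕ} (h : ∀ m : ℕ, f + m • g ∈ UniversalOCA n)
    {k : ℕ} (hk : k < n - 1) :
    0 ≤ ∑ i ∈ Finset.univ.filter (fun i : Fin n => (i : ℕ) ≤ k),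
      (-1 : ℤ) ^ (i : ℕ) * (g (.a i) : ℤ) := by
  set F := ∑ i ∈ Finset.univ.filter (fun i : Fin n => (i : ℕ) ≤ k),
      (-1 : ℤ) ^ (i : ℕ) * (f (.a i) : ℤ) with hF
  set G := ∑ i ∈ Finset.univ.filter (fun i : Fin n => (i : ℕ) ≤ k),
      (-1 : ℤ) ^ (i : ℕ) * (g (.a i) : ℤ) with hG
  have hm : ∀ m : ℕ, 0 ≤ F + m * G := by
    intro m
    have := (h m).2.2.2.2.1 k hk
    simp only [Pi.add_apply, Pi.smul_apply, smul_eq_mul] at this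
    push_cast at this
    simp only [mul_add, Finset.sum_add_distrib, mul_left_comm _ (m : ℤ), ← Finset.mul_sum] at this
    exact this
  by_contra! hneg
  have := hm (F.natAbs + 1)
  push_cast at this
  nlinarith [le_abs_self F, abs_nonneg F]

theorem IsChainFor.suffix_sum_nonpos_of_pump {σ : List ℤ} {p : ℕ → Fin n} (hp : IsChainFor σ p)
    {f g : Alph n → ℕ} (h : ∀ m : ℕ, f + m • g ∈ UniversalOCA n)
    (hg : ∀ i, g (.a i) ≠ 0 → ∃ k < σ.length, p (k + 1) = i) {k₀ : ℕ} (hk₀ : k₀ < σ.length) :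
    ∑ k ∈ Finset.Ico k₀ σ.length, σ.getD k 0 * (g (.a (p (k + 1))) : ℤ) ≤ 0 := by
  have h0 := sum_eq_zero_of_pump h
  have hT := hp.sum_filter_eq (g := fun i => g (.a i)) (fun _ => True) hg
  simp only [Finset.filter_true] at hT
  rw [hT] at h0
  have hpos : (p 0 : ℕ) < p (k₀ + 1) := (hp.lt_iff (by omega) (by omega)).2 (by omega)
  have hlast : (p (k₀ + 1) : ℕ) < p (σ.length + 1) :=
    (hp.lt_iff (by omega) (by omega)).2 (by omega)
  rw [hp.last] at hlast
  have h1 := sum_nonneg_of_pump h (k := p (k₀ + 1) - 1) (by omega)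
  rw [hp.sum_filter_eq (g := fun i => g (.a i)) _ hg] at h1
  have hset : (Finset.range σ.length).filter (fun k => (p (k + 1) : ℕ) ≤ p (k₀ + 1) - 1) =
      Finset.range k₀ := by
    ext l
    rw [Finset.mem_filter, Finset.mem_range, Finset.mem_range]
    constructor
    · rintro ⟨h2, h3⟩
      have h4 : p (l + 1) < p (k₀ + 1) := by
        rw [Fin.lt_def]
        omega
      have := (hp.lt_iff (by omega) (by omega)).1 h4
      omega
    · intro h2
      have h4 := (hp.lt_iff (k := l + 1) (l := k₀ + 1) (by omega) (by omega)).2 (by omega)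
      rw [Fin.lt_def] at h4
      exact ⟨by omega, by omega⟩
  rw [hset] at h1
  rw [← Finset.sum_range_add_sum_Ico _ hk₀.le] at h0
  linarith

/-- A loop on an accepting run can be pumped inside the universal set. -/
theorem pump_mem {Q : Type*} {A : NFA (Alph n) Q} (hA : ParikhImage A = UniversalOCA n)
    {q : Q} {u γ v : List (Alph n)} (hu : q ∈ A.evalFrom A.start u) (hγ : q ∈ A.evalFrom {q} γ)
    (hv : ∃ r ∈ A.accept, r ∈ A.evalFrom {q} v) (m : ℕ) :
    (fun l => (u ++ v).count l) + m • (fun l => γ.count l) ∈ UniversalOCA n := by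
  rw [← hA]
  refine ⟨(u ++ (List.replicate m γ).flatten) ++ v, NFA.mem_accepts_append
    (NFA.mem_evalFrom_append_iff.2 ⟨q, hu, NFA.mem_evalFrom_flatten_replicate hγ m⟩) hv, ?_⟩
  intro l
  simp only [Pi.add_apply, Pi.smul_apply, smul_eq_mul, List.count_append, List.count_flatten,
    List.map_replicate, List.sum_replicate]
  ring

end UniversalSet

section Cuts

variable {n : ℕ} {Q : Type*} {A : NFA (Alph n) Q} {σ : List ℤ}

/-- A word `u ++ v` tracing the chain `p`, accepted through the state `q`, such that `u` visits
the vertices with index in `S` and `v` visits the others. -/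
structure IsCut (A : NFA (Alph n) Q) (σ : List ℤ) (p : ℕ → Fin n) (q : Q)
    (u v : List (Alph n)) (S : Finset ℕ) : Prop where
  run_left : q ∈ A.evalFrom A.start u
  run_right : ∃ r ∈ A.accept, r ∈ A.evalFrom {q} v
  edge_mem : ∀ e ≤ σ.length, Alph.c (p e) (p (e + 1)) ∈ u ∨ Alph.c (p e) (p (e + 1)) ∈ v
  edge_of_mem : ∀ i j, Alph.c i j ∈ u ∨ Alph.c i j ∈ v →
    ∃ e ≤ σ.length, p e = i ∧ p (e + 1) = j
  mem_left : ∀ k < σ.length, k ∈ S → Alph.a (p (k + 1)) ∈ u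
  mem_right : ∀ k < σ.length, k ∉ S → Alph.a (p (k + 1)) ∈ v

theorem IsChainFor.exists_cut [Fintype Q] (hA : ParikhImage A = UniversalOCA n) (hσ : IsDyck σ)
    (hw : 0 < dyckWidth σ) {p : ℕ → Fin n} (hp : IsChainFor σ p) :
    ∃ q u v S, IsCut A σ p q u v S ∧ S ⊆ Finset.range σ.length ∧ dyckWidth σ ≤ setWidth S := by
  set K := σ.length * Fintype.card Q + 1 with hK
  obtain ⟨w, ⟨r, hr, hrun⟩, hcount⟩ : chainVec p σ.length K ∈ ParikhImage A :=
    hA ▸ hp.chainVec_mem hσ K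
  obtain ⟨s, hs, hrun⟩ := NFA.mem_evalFrom_iff_exists.1 hrun
  obtain ⟨L, hL, hnd⟩ := NFA.LoopDecomp.exists_nodup hrun
  have hLQ : L.length ≤ Fintype.card Q := by simpa using hnd.length_le_card
  have hLpos : 0 < L.length := by
    have := hL.length_add_one
    rcases Nat.eq_zero_or_pos L.length with h | h
    · rw [List.length_eq_zero_iff] at h
      subst h
      simp at this
    · exact h
  have hletter : ∀ i, Alph.a i ∈ w → ∃ k < σ.length, p (k + 1) = i := by
    intro i hi
    have h1 := hcount (.a i)
    have h2 := List.count_pos_iff.2 hi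
    by_contra h
    simp only [chainVec, if_neg h] at h1
    omega
  have hinner : ∀ k < σ.length, w.count (.a (p (k + 1))) = K := by
    intro k hk
    rw [← hcount]
    simp only [chainVec]
    exact if_pos ⟨k, hk, rfl⟩
  have hsplit : ∀ (i : ℕ) (hi : i < L.length), ∃ u v, w = u ++ (L[i].2 ++ v) ∧
      L[i].1 ∈ A.evalFrom A.start u ∧ L[i].1 ∈ A.evalFrom {L[i].1} L[i].2 ∧
      (∃ r ∈ A.accept, r ∈ A.evalFrom {L[i].1} v) ∧
      (∀ j (hj : j < L.length), j < i → L[j].2 ⊆ u) ∧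
      ∀ j (hj : j < L.length), i < j → L[j].2 ⊆ v := by
    intro i hi
    obtain ⟨u, v, h1, h2, h3, h4, h5, h6⟩ := hL.split_at_loop i hi
    exact ⟨u, v, h1, NFA.mem_evalFrom_iff_exists.2 ⟨s, hs, h2⟩, h3, ⟨r, hr, h4⟩, h5, h6⟩
  have hsum : ∀ a, ∑ i : Fin L.length, L[i].2.count a = (L.map fun x => x.2.count a).sum :=
    fun a => Fin.sum_univ_fun_getElem L fun x => x.2.count a
  obtain ⟨S, hSN, hS, i, hi⟩ := hσ.exists_wide_split hw hLpos
    (fun i k => L[i].2.count (.a (p (k + 1)))) (K := K) (R := Fintype.card Q) (by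
      intro i k₀ hk₀
      obtain ⟨u, v, h1, h2, h3, h4, -, -⟩ := hsplit i i.2
      refine hp.suffix_sum_nonpos_of_pump (pump_mem hA h2 h3 h4) (fun j hj => hletter j ?_) hk₀
      rw [h1]
      simp [List.count_pos_iff.1 (Nat.pos_of_ne_zero hj)]) (by
      intro k hk
      rw [hsum, ← hinner k hk]
      exact (hL.sum_count_le _).1) (by
      intro k hk
      rw [hsum, ← hinner k hk]
      have := (hL.sum_count_le (.a (p (k + 1)))).2
      omega) (by omega)
  obtain ⟨u, v, h1, h2, h3, h4, h5, h6⟩ := hsplit i i.2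
  have hmem : ∀ l, l ∈ w ↔ l ∈ u ++ L[(i : ℕ)].2 ∨ l ∈ L[(i : ℕ)].2 ++ v := by
    intro l
    rw [h1]
    simp only [List.mem_append]
    tauto
  refine ⟨L[(i : ℕ)].1, u ++ L[(i : ℕ)].2, L[(i : ℕ)].2 ++ v, S, ⟨?_, ?_, ?_, ?_, ?_, ?_⟩, hSN, hS⟩
  · exact NFA.mem_evalFrom_append_iff.2 ⟨_, h2, h3⟩
  · obtain ⟨r', hr', h4⟩ := h4
    exact ⟨r', hr', NFA.mem_evalFrom_append_iff.2 ⟨_, h3, h4⟩⟩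
  · intro e he
    rw [← hmem, ← List.count_pos_iff, ← hcount]
    simp only [chainVec]
    rw [if_pos ⟨e, he, rfl, rfl⟩]
    exact one_pos
  · intro j j' hj
    rw [← hmem, ← List.count_pos_iff, ← hcount] at hj
    by_contra h
    simp only [chainVec, if_neg h, lt_irrefl] at hj
  · intro k hk hkS
    obtain ⟨j, hji, hj⟩ := (hi k hk).1 hkS
    have hj := List.count_pos_iff.1 hj
    rcases hji.lt_or_eq with hji | rfl
    · exact List.mem_append_left _ (h5 j j.2 hji hj)
    · exact List.mem_append_right _ hj
  · intro k hk hkS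
    obtain ⟨j, hji, hj⟩ := (hi k hk).2 hkS
    have hj := List.count_pos_iff.1 hj
    rcases hji.lt_or_eq with hji | rfl
    · exact List.mem_append_right _ (h6 j j.2 hji hj)
    · exact List.mem_append_left _ hj

theorem edge_eq_one_of_mem {W : List (Alph n)} (hW : (fun l => W.count l) ∈ UniversalOCA n)
    {i j : Fin n} : W.count (Alph.c i j) = 1 ↔ Alph.c i j ∈ W := by
  have := hW.2.1 i j
  rw [← List.count_pos_iff]
  simp only at this
  omega

/-- In a word of the universal language all of whose edges cross some threshold, two vertices
between consecutive thresholds that are both in use coincide. -/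
theorem eq_of_between_thresholds {W : List (Alph n)}
    (hW : (fun l => W.count l) ∈ UniversalOCA n) {N : ℕ} {T : ℕ → ℕ} (hT : Monotone T)
    (hT0 : 0 < T 0)
    (hcross : ∀ i j, Alph.c i j ∈ W → ∃ e ≤ N, (i : ℕ) < T e ∧ T e ≤ j) {k : ℕ} {x y : Fin n}
    (hx1 : T k ≤ x) (hx2 : (x : ℕ) < T (k + 1)) (hy1 : T k ≤ y) (hy2 : (y : ℕ) < T (k + 1))
    (hx : Alph.a x ∈ W ∨ ∃ j, Alph.c x j ∈ W ∨ Alph.c j x ∈ W)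
    (hy : Alph.a y ∈ W ∨ ∃ j, Alph.c y j ∈ W ∨ Alph.c j y ∈ W) : x = y := by
  have hTk := hT (Nat.zero_le k)
  have hvert : ∀ x : Fin n, T k ≤ x →
      (Alph.a x ∈ W ∨ ∃ j, Alph.c x j ∈ W ∨ Alph.c j x ∈ W) →
      ∃ j, W.count (Alph.c x j) = 1 ∨ W.count (Alph.c j x) = 1 := by
    intro x hx1 hx
    rcases hx with hx | ⟨j, hx⟩
    · obtain ⟨i, hi⟩ := (hW.2.2.2.2.2 x (List.count_pos_iff.2 hx)).1 (by omega)
      exact ⟨i, Or.inr hi⟩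
    · exact ⟨j, hx.imp (edge_eq_one_of_mem hW).2 (edge_eq_one_of_mem hW).2⟩
  have key : ∀ x y : Fin n, T k ≤ x → (y : ℕ) < T (k + 1) →
      (∃ j, W.count (Alph.c x j) = 1 ∨ W.count (Alph.c j x) = 1) →
      (∃ j, W.count (Alph.c y j) = 1 ∨ W.count (Alph.c j y) = 1) → ¬ x < y := by
    intro x y hx1 hy2 hx hy hlt
    obtain ⟨l, hl, hly⟩ := hW.2.2.1.exists_edge_le hx hy hlt
    obtain ⟨e, -, he1, he2⟩ := hcross _ _ ((edge_eq_one_of_mem hW).1 hl)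
    rw [Fin.le_def] at hly
    rcases Nat.lt_or_ge k e with h | h
    · have := hT (show k + 1 ≤ e from h)
      omega
    · have := hT h
      omega
  have h1 := key x y hx1 hy2 (hvert x hx1 hx) (hvert y hy1 hy)
  have h2 := key y x hy1 hx2 (hvert y hy1 hy) (hvert x hx1 hx)
  exact le_antisymm (not_lt.1 h2) (not_lt.1 h1)

/-- The chain `p` crosses the threshold `T e` with its `e`-th edge. -/
def Crosses (N : ℕ) (T : ℕ → ℕ) (p : ℕ → Fin n) : Prop :=
  ∀ e ≤ N, (p e : ℕ) < T e ∧ T e ≤ p (e + 1)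

namespace IsCut

variable {p p' : ℕ → Fin n} {q : Q} {u v u' v' : List (Alph n)} {S S' : Finset ℕ} {T : ℕ → ℕ}

theorem mix_mem (hA : ParikhImage A = UniversalOCA n) (hc : IsCut A σ p q u v S)
    (hc' : IsCut A σ p' q u' v' S') : (fun l => (u ++ v').count l) ∈ UniversalOCA n := by
  rw [← hA]
  exact ⟨_, NFA.mem_accepts_append hc.run_left hc'.run_right, fun _ => rfl⟩

theorem mix_crosses (hc : IsCut A σ p q u v S) (hc' : IsCut A σ p' q u' v' S')
    (hp : Crosses σ.length T p) (hp' : Crosses σ.length T p') (i j : Fin n)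
    (h : Alph.c i j ∈ u ++ v') : ∃ e ≤ σ.length, (i : ℕ) < T e ∧ T e ≤ j := by
  rcases List.mem_append.1 h with h | h
  · obtain ⟨e, he, rfl, rfl⟩ := hc.edge_of_mem _ _ (Or.inl h)
    exact ⟨e, he, hp e he⟩
  · obtain ⟨e, he, rfl, rfl⟩ := hc'.edge_of_mem _ _ (Or.inr h)
    exact ⟨e, he, hp' e he⟩

theorem edge_mem_left (hA : ParikhImage A = UniversalOCA n) (hc : IsCut A σ p q u v S)
    (hc' : IsCut A σ p' q u' v' S') (hp : Crosses σ.length T p) (hp' : Crosses σ.length T p')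
    {e : ℕ} (he : e ≤ σ.length) (h : Alph.c (p e) (p (e + 1)) ∈ u) :
    Alph.c (p' e) (p' (e + 1)) ∈ u' := by
  refine (hc'.edge_mem e he).resolve_right fun h' => ?_
  have hW := hc.mix_mem hA hc'
  have h1 := hp e he
  have h2 := hp' e he
  obtain ⟨h3, h4⟩ := hW.2.2.1.eq_of_overlap
    ((edge_eq_one_of_mem hW).2 (List.mem_append_left _ h))
    ((edge_eq_one_of_mem hW).2 (List.mem_append_right _ h'))
    (Fin.lt_def.2 (by omega)) (Fin.lt_def.2 (by omega))
  rw [← h3, ← h4] at h'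
  have h5 := hW.2.1 (p e) (p (e + 1))
  simp only [List.count_append] at h5
  have h6 := List.count_pos_iff.2 h'
  have h7 := List.count_pos_iff.2 h
  omega

/-- The indices of vertices visited on the side of the cut opposite to an incident edge. -/
noncomputable def conflict (σ : List ℤ) (p : ℕ → Fin n) (u : List (Alph n)) (S : Finset ℕ) :
    Finset (Fin σ.length) := by
  classical
  exact Finset.univ.filter fun k => ∃ e, (e = (k : ℕ) ∨ e = k + 1) ∧
    ((k : ℕ) ∈ S ↔ Alph.c (p e) (p (e + 1)) ∉ u)

theorem mem_conflict {k : Fin σ.length} : k ∈ conflict σ p u S ↔ ∃ e, (e = (k : ℕ) ∨ e = k + 1) ∧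
    ((k : ℕ) ∈ S ↔ Alph.c (p e) (p (e + 1)) ∉ u) := by
  simp only [conflict, Finset.mem_filter, Finset.mem_univ, true_and]

theorem setWidth_le (hS : S ⊆ Finset.range σ.length) :
    setWidth S ≤ 2 * (conflict σ p u S).card + 1 := by
  rw [← Finset.card_map Fin.valEmbedding]
  have hmem : ∀ k (hk : k < σ.length), k ∉ (conflict σ p u S).map Fin.valEmbedding →
      ∀ e, (e = k ∨ e = k + 1) → (k ∈ S ↔ Alph.c (p e) (p (e + 1)) ∈ u) := by
    intro k hk hkD e he
    by_contra h
    refine hkD (Finset.mem_map.2 ⟨⟨k, hk⟩, mem_conflict.2 ⟨e, he, ?_⟩, rfl⟩)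
    simp only
    tauto
  refine setWidth_le_of_agree (E := fun e => Alph.c (p e) (p (e + 1)) ∈ u) hS ?_ ?_
  · intro k hk hkS hkD
    exact (hmem k hk hkD _ (Or.inr rfl)).1 hkS
  · intro k hk hkS hkD h
    exact hkS ((hmem k hk hkD _ (Or.inl rfl)).2 h)

theorem eq_of_mem_conflict (hA : ParikhImage A = UniversalOCA n) (hc : IsCut A σ p q u v S)
    (hc' : IsCut A σ p' q u' v' S') (hT : Monotone T) (hT0 : 0 < T 0)
    (hp : Crosses σ.length T p) (hp' : Crosses σ.length T p')
    {k : Fin σ.length} (hk : k ∈ conflict σ p u S) : p (k + 1) = p' (k + 1) := by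
  obtain ⟨e, he, hiff⟩ := mem_conflict.1 hk
  have hkN := k.2
  have heN : e ≤ σ.length := by omega
  have h1 := hp k hkN.le
  have h2 := hp (k + 1) hkN
  have h1' := hp' k hkN.le
  have h2' := hp' (k + 1) hkN
  have htouch : ∀ W : List (Alph n), Alph.c (p' e) (p' (e + 1)) ∈ W →
      ∃ j, Alph.c (p' (k + 1)) j ∈ W ∨ Alph.c j (p' (k + 1)) ∈ W := by
    intro W hW
    rcases he with rfl | rfl
    · exact ⟨_, Or.inr hW⟩
    · exact ⟨_, Or.inl hW⟩
  by_cases hkS : (k : ℕ) ∈ S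
  · have hedge : Alph.c (p' e) (p' (e + 1)) ∈ v' :=
      (hc'.edge_mem e heN).resolve_left fun h =>
        hiff.1 hkS (hc'.edge_mem_left hA hc hp' hp heN h)
    exact eq_of_between_thresholds (hc.mix_mem hA hc') hT hT0 (hc.mix_crosses hc' hp hp')
      h1.2 h2.1 h1'.2 h2'.1 (Or.inl (List.mem_append_left _ (hc.mem_left k hkN hkS)))
      (Or.inr (htouch _ (List.mem_append_right _ hedge)))
  · have hedge : Alph.c (p' e) (p' (e + 1)) ∈ u' :=
      hc.edge_mem_left hA hc' hp hp' heN (by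
        by_contra h
        exact hkS (hiff.2 h))
    exact eq_of_between_thresholds (hc'.mix_mem hA hc) hT hT0 (hc'.mix_crosses hc hp' hp)
      h1.2 h2.1 h1'.2 h2'.1 (Or.inl (List.mem_append_right _ (hc.mem_right k hkN hkS)))
      (Or.inr (htouch _ (List.mem_append_left _ hedge)))

end IsCut

end Cuts

theorem card_le_pow_of_agree {N B : ℕ} {F : Finset (Fin N → Fin B)} {x₀ : Fin N → Fin B}
    {D : Finset (Fin N)} (h : ∀ x ∈ F, ∀ k ∈ D, x k = x₀ k) : F.card ≤ B ^ (N - D.card) := by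
  classical
  have hinj : Function.Injective
      (fun (x : F) (k : {k // k ∉ D}) => (x : Fin N → Fin B) k) := by
    intro x y hxy
    ext1
    funext k
    by_cases hk : k ∈ D
    · rw [h x x.2 k hk, h y y.2 k hk]
    · exact congrFun hxy ⟨k, hk⟩
  have := Fintype.card_le_of_injective _ hinj
  rwa [Fintype.card_coe, Fintype.card_fun, Fintype.card_fin, Fintype.card_subtype_compl,
    Fintype.card_fin, Fintype.card_coe] at this

/-- Chains whose `k`-th inner vertex is chosen freely within the `k`-th of `N` disjoint blocks. -/
theorem exists_blockChain {n B : ℕ} {σ : List ℤ} (hσ : IsDyck σ) (hn : 2 * (B * σ.length) + 2 < n) :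
    ∃ p : (Fin σ.length → Fin B) → ℕ → Fin n, (∀ x, IsChainFor σ (p x)) ∧
      (∀ x, Crosses σ.length (fun e => 2 * (B * e) + 2) (p x)) ∧
      ∀ x y (k : Fin σ.length), p x (k + 1) = p y (k + 1) → x k = y k := by
  let pos : (Fin σ.length → Fin B) → ℕ → ℕ := fun x k =>
    match k with
    | 0 => 0
    | k + 1 => if h : k < σ.length then
        2 * (B * k + x ⟨k, h⟩) + 2 + (if σ.getD k 0 = 1 then 0 else 1) else n - 1
  have hin : ∀ x k (h : k < σ.length), pos x (k + 1) =
      2 * (B * k + x ⟨k, h⟩) + 2 + (if σ.getD k 0 = 1 then 0 else 1) := fun x k h => dif_pos h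
  have hout : ∀ x, pos x (σ.length + 1) = n - 1 := fun x => dif_neg (lt_irrefl _)
  have hlow : ∀ x e, e ≤ σ.length → 2 * (B * e) + 2 ≤ pos x (e + 1) := by
    intro x e he
    rcases he.lt_or_eq with he | rfl
    · rw [hin x e he]
      split <;> omega
    · rw [hout]
      omega
  have hup : ∀ x e, e ≤ σ.length → pos x e < 2 * (B * e) + 2 := by
    intro x e he
    cases e with
    | zero => simp [pos]
    | succ e =>
      rw [hin x e he]
      have := (x ⟨e, he⟩).2
      rw [Nat.mul_succ]
      split <;> omega
  have hmul : ∀ a b, a ≤ b → B * a ≤ B * b := fun a b h => Nat.mul_le_mul_left B h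
  have hlt : ∀ x k, pos x k < n := by
    intro x k
    cases k with
    | zero => simp only [pos]; omega
    | succ k =>
      by_cases h : k < σ.length
      · have h1 := hup x (k + 1) h
        have h2 := hmul (k + 1) σ.length h
        omega
      · simp only [pos, dif_neg h]
        omega
  refine ⟨fun x k => ⟨pos x k, hlt x k⟩, fun x => ⟨?_, rfl, hout x, ?_⟩, ?_, ?_⟩
  · intro a ha b hb hab
    rw [Fin.lt_def]
    simp only [Set.mem_Iic] at ha hb
    obtain ⟨c, rfl⟩ : ∃ c, b = c + 1 := ⟨b - 1, by omega⟩
    have h1 := hup x a (by omega)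
    have h2 := hlow x c (by omega)
    have h3 := hmul a c (by omega)
    simp only
    omega
  · intro k hk
    simp only [hin x k hk]
    rcases hσ.getD_eq hk with h | h
    · rw [h, if_pos rfl]
      exact Even.neg_one_pow ⟨B * k + x ⟨k, hk⟩ + 1, by ring⟩
    · rw [h, if_neg (by norm_num)]
      exact Odd.neg_one_pow ⟨B * k + x ⟨k, hk⟩ + 1, by ring⟩
  · intro x e he
    exact ⟨hup x e he, hlow x e he⟩
  · intro x y k h
    have h := congrArg Fin.val h
    simp only [hin x k k.2, hin y k k.2] at h
    have h' : (x k : ℕ) = y k := by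
      simp only [Fin.eta] at h
      omega
    exact Fin.ext h'

theorem pow_le_card_of_width {n B : ℕ} (hB : 0 < B) {σ : List ℤ} (hσ : IsDyck σ)
    (hn : 2 * (B * σ.length) + 2 < n) (hw : 0 < dyckWidth σ) {Q : Type*} [Fintype Q]
    {A : NFA (Alph n) Q} (hA : ParikhImage A = UniversalOCA n) :
    B ^ (dyckWidth σ / 2) ≤ Fintype.card Q := by
  classical
  obtain ⟨p, hp, hcross, hinj⟩ := exists_blockChain hσ hn
  choose q u v S hc hSN hS using fun x => (hp x).exists_cut hA hσ hw
  have hT : Monotone fun e => 2 * (B * e) + 2 := fun a b hab => by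
    have := Nat.mul_le_mul_left B hab
    simp only
    omega
  have hD : ∀ x, dyckWidth σ / 2 ≤ (IsCut.conflict σ (p x) (u x) (S x)).card := by
    intro x
    have h1 := IsCut.setWidth_le (p := p x) (u := u x) (hSN x)
    have h2 := hS x
    omega
  have hfib : ∀ s ∈ (Finset.univ : Finset Q),
      (Finset.univ.filter fun x => q x = s).card ≤ B ^ (σ.length - dyckWidth σ / 2) := by
    intro s _
    rcases (Finset.univ.filter fun x => q x = s).eq_empty_or_nonempty with he | ⟨x₀, hx₀⟩
    · simp [he]
    · have hx₀ := (Finset.mem_filter.1 hx₀).2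
      refine (card_le_pow_of_agree (x₀ := x₀)
        (D := IsCut.conflict σ (p x₀) (u x₀) (S x₀)) ?_).trans
        (Nat.pow_le_pow_right hB (Nat.sub_le_sub_left (hD x₀) _))
      intro x hx k hk
      have hx := (Finset.mem_filter.1 hx).2
      have hcx := hc x
      rw [hx, ← hx₀] at hcx
      exact (hinj x₀ x k ((hc x₀).eq_of_mem_conflict hA hcx hT (by simp) (hcross x₀) (hcross x)
        hk)).symm
  have hcount := Finset.card_le_mul_card_image_of_maps_to
    (fun x _ => Finset.mem_univ (q x)) _ hfib
  rw [Finset.card_univ, Finset.card_univ, Fintype.card_fun, Fintype.card_fin,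
    Fintype.card_fin] at hcount
  have hle : dyckWidth σ / 2 ≤ σ.length := by
    refine (hD fun _ => ⟨0, hB⟩).trans ?_
    simpa using Finset.card_le_univ (IsCut.conflict σ (p fun _ => ⟨0, hB⟩) (u fun _ => ⟨0, hB⟩)
      (S fun _ => ⟨0, hB⟩))
  rw [← Nat.sub_add_cancel hle, pow_add, Nat.sub_add_cancel hle] at hcount
  exact Nat.le_of_mul_le_mul_left hcount (Nat.pow_pos hB)

/-- The chain through all vertices already forces `n` states. -/
theorem le_card_of_parikhImage_eq {n : ℕ} (hn : 0 < n) {Q : Type*} [Fintype Q]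
    {A : NFA (Alph n) Q} (hA : ParikhImage A = UniversalOCA n) : n ≤ Fintype.card Q := by
  classical
  let f : Alph n → ℕ
  | .c i j => if (i : ℕ) + 1 = j then 1 else 0
  | .a _ => 0
  have hf : f ∈ UniversalOCA n := by
    refine ⟨?_, ?_, ⟨n - 1, fun t => ⟨t, by omega⟩, ?_, rfl, rfl, ?_⟩, ?_, ?_, ?_⟩
    · intro i j hij
      refine if_neg fun h => hij (Fin.lt_def.2 (by omega))
    · intro i j
      simp only [f]
      split <;> simp
    · intro a b hab
      exact hab
    · intro i j
      simp only [f, ite_eq_left_iff, zero_ne_one, imp_false, not_not]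
      constructor
      · intro h
        exact ⟨⟨i, by omega⟩, rfl, Fin.ext h⟩
      · rintro ⟨t, rfl, rfl⟩
        rfl
    · simp [f]
    · simp [f]
    · simp [f]
  obtain ⟨w, ⟨r, hr, hrun⟩, hcount⟩ : f ∈ ParikhImage A := hA ▸ hf
  obtain ⟨s, hs, hrun⟩ := NFA.mem_evalFrom_iff_exists.1 hrun
  obtain ⟨L, hL, hnd⟩ := NFA.LoopDecomp.exists_nodup hrun
  have hLQ : L.length ≤ Fintype.card Q := by simpa using hnd.length_le_card
  have hloop : ∀ x ∈ L, x.2 = [] := by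
    intro x hx
    obtain ⟨i, hi, rfl⟩ := List.mem_iff_getElem.1 hx
    obtain ⟨u, v, h1, h2, h3, h4, -⟩ := hL.split_at_loop i hi
    have hpump := pump_mem hA (NFA.mem_evalFrom_iff_exists.2 ⟨s, hs, h2⟩) h3 ⟨r, hr, h4⟩
    refine List.eq_nil_iff_forall_not_mem.2 fun l hl => ?_
    cases l with
    | c i j => exact (List.count_pos_iff.2 hl).ne' (eq_zero_of_pump hpump i j)
    | a i =>
      have h5 : Alph.a i ∈ w := by
        rw [h1]
        simp [hl]
      exact (List.count_pos_iff.2 h5).ne' (hcount (.a i)).symm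
  have hlen := hL.length_add_one
  rw [List.map_congr_left (g := fun _ => 0) fun x hx => by rw [hloop x hx, List.length_nil]] at hlen
  have hwlen : n - 1 ≤ w.length := by
    have hsub : (Finset.univ : Finset (Fin (n - 1))).image
        (fun t : Fin (n - 1) => Alph.c (⟨t, by omega⟩ : Fin n) ⟨t + 1, by omega⟩) ⊆ w.toFinset := by
      intro l hl
      obtain ⟨t, -, rfl⟩ := Finset.mem_image.1 hl
      rw [List.mem_toFinset, ← List.count_pos_iff, ← hcount]
      simp [f]
    have := (Finset.card_le_card hsub).trans w.toFinset_card_le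
    rwa [Finset.card_image_of_injective, Finset.card_univ, Fintype.card_fin] at this
    intro a b hab
    simpa [Fin.ext_iff] using hab
  simp at hlen
  omega

/-- For every Dyck word σ of length O(√n), every NFA whose language has Parikh
image equal to the universal one-counter set Uₙ has at least n^{Ω(width(σ))}
states. -/
theorem nfa_states_lower_of_width : ∃ (c c' : ℝ) (N : ℕ), 0 < c ∧ 0 < c' ∧
    ∀ n : ℕ, Even n → N ≤ n →
    ∀ σ : List ℤ, IsDyck σ → (σ.length : ℝ) ≤ c * Real.sqrt (n : ℝ) →
    ∀ (Q : Type) [Fintype Q] (A : NFA (Alph n) Q),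
      ParikhImage A = UniversalOCA n →
      (n : ℝ) ^ (c' * (dyckWidth σ : ℝ)) ≤ (Fintype.card Q : ℝ) := by
  refine ⟨1 / 8, 1 / 12, 4, by norm_num, by norm_num, ?_⟩
  intro n _ hn σ hσ hlen Q _ A hA
  have hn1 : (1 : ℝ) ≤ n := by exact_mod_cast (by omega : 1 ≤ n)
  have hn0 : (0 : ℝ) ≤ n := by linarith
  rcases Nat.lt_or_ge (dyckWidth σ) 2 with hw | hw
  · have hcard : (n : ℝ) ≤ Fintype.card Q := by
      exact_mod_cast le_card_of_parikhImage_eq (by omega) hA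
    have hw1 : (dyckWidth σ : ℝ) ≤ 1 := by exact_mod_cast (by omega : dyckWidth σ ≤ 1)
    calc (n : ℝ) ^ (1 / 12 * (dyckWidth σ : ℝ)) ≤ (n : ℝ) ^ (1 : ℝ) :=
          Real.rpow_le_rpow_of_exponent_le hn1 (by linarith)
      _ = n := Real.rpow_one _
      _ ≤ _ := hcard
  · set B := Nat.sqrt n with hB
    have hB2 : 2 ≤ B := Nat.le_sqrt.2 (by omega)
    have hBn : n ≤ B ^ 4 := by
      have h1 : n < (B + 1) * (B + 1) := Nat.lt_succ_sqrt n
      nlinarith [Nat.mul_le_mul hB2 hB2, Nat.pow_le_pow_left hB2 2]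
    have hfit : 2 * (B * σ.length) + 2 < n := by
      have h1 : (B : ℝ) ≤ Real.sqrt n := Real.nat_sqrt_le_real_sqrt
      have h2 : (B : ℝ) * σ.length ≤ Real.sqrt n * (1 / 8 * Real.sqrt n) :=
        mul_le_mul h1 hlen (Nat.cast_nonneg _) (Real.sqrt_nonneg _)
      have h3 : Real.sqrt n * Real.sqrt n = n := Real.mul_self_sqrt hn0
      have h4 : (4 : ℝ) ≤ n := by exact_mod_cast hn
      have h5 : 2 * ((B : ℝ) * σ.length) + 2 < n := by nlinarith
      exact_mod_cast h5
    have hcard : (B : ℝ) ^ (dyckWidth σ / 2) ≤ Fintype.card Q := by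
      exact_mod_cast pow_le_card_of_width (by omega) hσ hfit (by omega) hA
    refine le_trans ?_ hcard
    have hBn' : (n : ℝ) ≤ (B : ℝ) ^ (4 : ℝ) := by exact_mod_cast hBn
    have hB1 : (1 : ℝ) ≤ B := by exact_mod_cast (by omega : 1 ≤ B)
    have hexp : 4 * (1 / 12 * (dyckWidth σ : ℝ)) ≤ ((dyckWidth σ / 2 : ℕ) : ℝ) := by
      have : (dyckWidth σ : ℝ) ≤ 3 * ((dyckWidth σ / 2 : ℕ) : ℝ) := by
        exact_mod_cast (by omega : dyckWidth σ ≤ 3 * (dyckWidth σ / 2))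
      linarith
    calc (n : ℝ) ^ (1 / 12 * (dyckWidth σ : ℝ))
        ≤ ((B : ℝ) ^ (4 : ℝ)) ^ (1 / 12 * (dyckWidth σ : ℝ)) :=
          Real.rpow_le_rpow hn0 hBn' (by positivity)
      _ = (B : ℝ) ^ (4 * (1 / 12 * (dyckWidth σ : ℝ))) := (Real.rpow_mul (by linarith) _ _).symm
      _ ≤ (B : ℝ) ^ ((dyckWidth σ / 2 : ℕ) : ℝ) := Real.rpow_le_rpow_of_exponent_le hB1 hexp
      _ = _ := Real.rpow_natCast _ _
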